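/- arXiv:1805.06859 — 2 statements merged into one kernel-verified Lean document; each statement's English description precedes it below -/
import Mathlib

section
/- For every integer n ≥ 1, the limit as ε → 0⁺ of the complex integral ∫_{Sⁿ} (x₀ − εi)^{−n} dσ(x) exists and equals iⁿ · σ(Sⁿ). (This is the paper's Theorem 1.1, V_n(DHⁿ) = iⁿ V_n(Sⁿ), expressed in the hemisphere model: the total volume of the double hyperbolic space equals iⁿ times the surface volume of the unit n-sphere.) -/
open MeasureTheory Filter Metric

/-- The spherical surface measure on the unit sphere `Sⁿ ⊆ ℝ^{n+1}`, obtained from the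
polar decomposition of Lebesgue measure. -/
noncomputable def sphereMeasure (n : ℕ) :
    Measure (sphere (0 : EuclideanSpace ℝ (Fin (n + 1))) 1) :=
  (volume : Measure (EuclideanSpace ℝ (Fin (n + 1)))).toSphere

open Set Asymptotics Topology
open scoped RealInnerProductSpace

section SphereIntegration

theorem integrableOn_pow_mul_exp_neg (k : ℕ) :
    IntegrableOn (fun r : ℝ ↦ r ^ k * Real.exp (-r)) (Ioi 0) := by
  refine (Real.GammaIntegral_convergent (s := k + 1) (by positivity)).congr_fun
    (fun r _ ↦ ?_) measurableSet_Ioi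
  simp [mul_comm]

theorem integral_pow_mul_exp_neg (k : ℕ) :
    ∫ r in Ioi (0 : ℝ), r ^ k * Real.exp (-r) = k.factorial := by
  rw [← Real.Gamma_nat_eq_factorial, Real.Gamma_eq_integral (by positivity)]
  refine setIntegral_congr_fun measurableSet_Ioi fun r _ ↦ ?_
  simp [mul_comm]

variable {E : Type*} [NormedAddCommGroup E] [InnerProductSpace ℝ E]

/-- The line derivative along `e` of the zonal function `x ↦ ‖x‖² exp(-‖x‖) g(⟪e, x⟫ / ‖x‖)`. -/
theorem hasLineDerivAt_zonal (e : E) {g g' : ℝ → ℂ} (hg : ∀ t, HasDerivAt g (g' t) t) (x : E) :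
    HasLineDerivAt ℝ
      (fun x : E ↦ ((‖x‖ ^ 2 * Real.exp (-‖x‖) : ℝ) : ℂ) * g (⟪e, x⟫ / ‖x‖))
      (((2 * ‖x‖ - ‖x‖ ^ 2) * Real.exp (-‖x‖) : ℝ) * ((⟪e, x⟫ / ‖x‖ : ℝ) * g (⟪e, x⟫ / ‖x‖)) +
        (‖x‖ * Real.exp (-‖x‖) : ℝ) *
          ((‖e‖ ^ 2 - (⟪e, x⟫ / ‖x‖) ^ 2 : ℝ) * g' (⟪e, x⟫ / ‖x‖))) x e := by
  rw [HasLineDerivAt]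
  rcases eq_or_ne x 0 with rfl | hx
  · have hgc : Continuous g := continuous_iff_continuousAt.2 fun t ↦ (hg t).continuousAt
    obtain ⟨C, hC⟩ := (isCompact_Icc (a := -‖e‖) (b := ‖e‖)).exists_bound_of_continuousOn
      hgc.continuousOn
    have hbd (y : E) : ‖g (⟪e, y⟫ / ‖y‖)‖ ≤ C := by
      refine hC _ (abs_le.1 ?_)
      rw [abs_div, abs_norm]
      exact div_le_of_le_mul₀ (norm_nonneg _) (norm_nonneg _) (abs_real_inner_le_norm e y)
    have key : (fun t : ℝ ↦ ((‖(0 : E) + t • e‖ ^ 2 * Real.exp (-‖(0 : E) + t • e‖) : ℝ) : ℂ) *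
        g (⟪e, (0 : E) + t • e⟫ / ‖(0 : E) + t • e‖)) =O[𝓝 0] fun t ↦ ‖t - 0‖ ^ 2 := by
      refine IsBigO.of_bound (‖e‖ ^ 2 * C) (.of_forall fun t ↦ ?_)
      have h1 : Real.exp (-‖(0 : E) + t • e‖) ≤ 1 := by simp
      have h0 := (Real.exp_pos (-‖(0 : E) + t • e‖)).le
      have hn : ‖(0 : E) + t • e‖ = |t| * ‖e‖ := by simp [norm_smul]
      rw [norm_mul, Complex.norm_real, Real.norm_of_nonneg (by positivity), sub_zero, norm_pow,
        norm_norm, Real.norm_eq_abs]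
      calc _ ≤ (‖(0 : E) + t • e‖ ^ 2 * 1) * C := by
            gcongr
            exact hbd _
        _ = _ := by rw [hn]; ring
    simpa using (key.hasFDerivAt one_lt_two).hasDerivAt
  · have hr0 : ‖x‖ ≠ 0 := norm_ne_zero_iff.2 hx
    have hl : HasDerivAt (fun t : ℝ ↦ x + t • e) e 0 := by
      simpa using ((hasDerivAt_id (0 : ℝ)).smul_const e).const_add x
    have hr : HasDerivAt (fun t : ℝ ↦ ‖x + t • e‖) (⟪e, x⟫ / ‖x‖) 0 := by
      have := hl.norm_sq.sqrt (by simpa using hx)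
      simp only [Real.sqrt_sq (norm_nonneg _)] at this
      convert! this using 1
      simp only [zero_smul, add_zero, real_inner_comm]
      field_simp
    have hi : HasDerivAt (fun t : ℝ ↦ ⟪e, x + t • e⟫) (‖e‖ ^ 2) 0 := by
      simpa using (hasDerivAt_const (0 : ℝ) e).inner ℝ hl
    have hg0 := (hg (⟪e, x + (0 : ℝ) • e⟫ / ‖x + (0 : ℝ) • e‖)).scomp (0 : ℝ)
      (hi.fun_div hr (by simpa using hx))
    convert! ((hr.fun_pow 2).fun_mul hr.fun_neg.exp).ofReal_comp.mul hg0 using 1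
    simp only [zero_smul, add_zero, Complex.real_smul, Function.comp_apply]
    push_cast
    have : ((‖x‖ : ℝ) : ℂ) ≠ 0 := by exact_mod_cast hr0
    field_simp
    ring

variable [FiniteDimensional ℝ E] [MeasurableSpace E] [BorelSpace E] [Nontrivial E]
  (μ : Measure E) [μ.IsAddHaarMeasure]

/-- Integration in polar coordinates of a function with separated variables. -/
theorem integrable_and_integral_eq_of_polar {f : E → ℂ} {q : ℝ → ℝ} {p : sphere (0 : E) 1 → ℂ}
    (hf : ∀ (u : sphere (0 : E) 1) (r : ℝ), 0 < r → f (r • (u : E)) = p u * q r)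
    (hq : IntegrableOn (fun r ↦ r ^ (Module.finrank ℝ E - 1) * q r) (Ioi 0))
    (hp : Integrable p μ.toSphere) :
    Integrable f μ ∧ ∫ x, f x ∂μ =
      (∫ u, p u ∂μ.toSphere) * (∫ r in Ioi 0, r ^ (Module.finrank ℝ E - 1) * q r : ℝ) := by
  set d := Module.finrank ℝ E - 1
  have hcomp (x : ({0}ᶜ : Set E)) :
      f x = (fun y : sphere (0 : E) 1 × Ioi (0 : ℝ) ↦ p y.1 * q y.2)
        (homeomorphUnitSphereProd E x) := by
    refine Eq.trans (congrArg f ?_) (hf _ _ (homeomorphUnitSphereProd E x).2.2)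
    exact (congrArg Subtype.val ((homeomorphUnitSphereProd E).symm_apply_apply x)).symm
  have hr : Integrable (fun r : Ioi (0 : ℝ) ↦ ((q r : ℝ) : ℂ)) (Measure.volumeIoiPow d) := by
    refine Integrable.ofReal (f := fun r : Ioi (0 : ℝ) ↦ q r) ?_
    rw [Measure.volumeIoiPow, integrable_withDensity_iff_integrable_smul' (by fun_prop) (by simp)]
    rw [integrableOn_iff_comap_subtypeVal measurableSet_Ioi] at hq
    refine hq.congr (.of_forall fun r ↦ ?_)
    simp [ENNReal.toReal_ofReal (pow_nonneg r.2.out.le d)]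
  constructor
  · rw [← restrict_compl_singleton (μ := μ) 0, ← IntegrableOn,
      integrableOn_iff_comap_subtypeVal (by measurability)]
    refine ((μ.measurePreserving_homeomorphUnitSphereProd.integrable_comp_emb
      (Homeomorph.measurableEmbedding _)).2 (hp.mul_prod hr)).congr (.of_forall fun x ↦ ?_)
    exact (hcomp x).symm
  · calc
      ∫ x, f x ∂μ = ∫ x : ({(0)}ᶜ : Set E), f x ∂(μ.comap (↑)) := by
        rw [integral_subtype_comap (measurableSet_singleton _).compl f, restrict_compl_singleton]
      _ = ∫ y : sphere (0 : E) 1 × Ioi (0 : ℝ), p y.1 * q y.2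
          ∂μ.toSphere.prod (.volumeIoiPow d) := by
        simp_rw [hcomp]
        exact μ.measurePreserving_homeomorphUnitSphereProd.integral_comp
          (Homeomorph.measurableEmbedding _)
          (fun y : sphere (0 : E) 1 × Ioi (0 : ℝ) ↦ p y.1 * (q y.2 : ℂ))
      _ = (∫ u, p u ∂μ.toSphere) * ∫ r : Ioi (0 : ℝ), (q r : ℂ) ∂.volumeIoiPow d :=
        integral_prod_mul _ (fun r : Ioi (0 : ℝ) ↦ ((q r : ℝ) : ℂ))
      _ = _ := by
        congr 1
        rw [integral_complex_ofReal (f := fun r : Ioi (0 : ℝ) ↦ q r), Measure.volumeIoiPow]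
        simp only [ENNReal.ofReal]
        rw [integral_withDensity_eq_integral_smul
            (measurable_subtype_coe.pow_const _).real_toNNReal,
          integral_subtype_comap measurableSet_Ioi fun a ↦ Real.toNNReal (a ^ d) • q a,
          setIntegral_congr_fun measurableSet_Ioi fun x hx ↦ ?_]
        rw [NNReal.smul_def, Real.coe_toNNReal _ (pow_nonneg hx.out.le _), smul_eq_mul]

/-- The divergence theorem on the sphere for the vector field `x ↦ g(⟪e, x⟫) (e - ⟪e, x⟫ x)`. -/
theorem integral_toSphere_divergence_eq_zero (e : E) {g g' : ℝ → ℂ}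
    (hg : ∀ t, HasDerivAt g (g' t) t) (hg' : Continuous g') :
    ∫ u : sphere (0 : E) 1,
      ((‖e‖ ^ 2 - ⟪e, (u : E)⟫ ^ 2 : ℝ) * g' ⟪e, (u : E)⟫ -
        (Module.finrank ℝ E - 1 : ℕ) * (⟪e, (u : E)⟫ * g ⟪e, (u : E)⟫)) ∂μ.toSphere = 0 := by
  have hgc : Continuous g := continuous_iff_continuousAt.2 fun t ↦ (hg t).continuousAt
  have hint (p : sphere (0 : E) 1 → ℂ) (hp : Continuous p) : Integrable p μ.toSphere :=
    hp.integrable_of_hasCompactSupport (.of_compactSpace _)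
  have hs (u : sphere (0 : E) 1) (r : ℝ) (hr : 0 < r) :
      ‖r • (u : E)‖ = r ∧ ⟪e, r • (u : E)⟫ / r = ⟪e, (u : E)⟫ := by
    constructor
    · simp [norm_smul, abs_of_pos hr]
    · rw [real_inner_smul_right]; field_simp
  have hq2 (d : ℕ) (r : ℝ) : r ^ d * (r ^ 2 * Real.exp (-r)) = r ^ (d + 2) * Real.exp (-r) :=
    by ring
  have hq1 (d : ℕ) (r : ℝ) : r ^ d * (r * Real.exp (-r)) = r ^ (d + 1) * Real.exp (-r) :=
    by ring
  have hq3 (d : ℕ) (r : ℝ) : r ^ d * ((2 * r - r ^ 2) * Real.exp (-r)) =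
      2 * (r ^ (d + 1) * Real.exp (-r)) - r ^ (d + 2) * Real.exp (-r) :=
    by ring
  obtain ⟨hΦ, -⟩ := integrable_and_integral_eq_of_polar μ
    (f := fun x : E ↦ ((‖x‖ ^ 2 * Real.exp (-‖x‖) : ℝ) : ℂ) * g (⟪e, x⟫ / ‖x‖))
    (q := fun r ↦ r ^ 2 * Real.exp (-r)) (p := fun u ↦ g ⟪e, (u : E)⟫)
    (fun u r hr ↦ by simp only [(hs u r hr).1, (hs u r hr).2]; ring)
    (by simpa only [hq2] using integrableOn_pow_mul_exp_neg (_ + 2))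
    (hint _ (by fun_prop))
  obtain ⟨hA, hA'⟩ := integrable_and_integral_eq_of_polar μ
    (f := fun x : E ↦ ((2 * ‖x‖ - ‖x‖ ^ 2) * Real.exp (-‖x‖) : ℝ) *
      ((⟪e, x⟫ / ‖x‖ : ℝ) * g (⟪e, x⟫ / ‖x‖)))
    (q := fun r ↦ (2 * r - r ^ 2) * Real.exp (-r)) (p := fun u ↦ ⟪e, (u : E)⟫ * g ⟪e, (u : E)⟫)
    (fun u r hr ↦ by simp only [(hs u r hr).1, (hs u r hr).2]; ring)
    (by
      simp only [hq3]
      exact Integrable.sub ((integrableOn_pow_mul_exp_neg (_ + 1)).const_mul 2)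
        (integrableOn_pow_mul_exp_neg (_ + 2)))
    (hint _ (by fun_prop))
  obtain ⟨hB, hB'⟩ := integrable_and_integral_eq_of_polar μ
    (f := fun x : E ↦ (‖x‖ * Real.exp (-‖x‖) : ℝ) *
      ((‖e‖ ^ 2 - (⟪e, x⟫ / ‖x‖) ^ 2 : ℝ) * g' (⟪e, x⟫ / ‖x‖)))
    (q := fun r ↦ r * Real.exp (-r))
    (p := fun u ↦ (‖e‖ ^ 2 - ⟪e, (u : E)⟫ ^ 2 : ℝ) * g' ⟪e, (u : E)⟫)
    (fun u r hr ↦ by simp only [(hs u r hr).1, (hs u r hr).2]; ring)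
    (by simpa only [hq1] using integrableOn_pow_mul_exp_neg (_ + 1))
    (hint _ (by fun_prop))
  have hzero := integral_bilinear_hasLineDerivAt_right_eq_neg_left_of_integrable (μ := μ)
    (f := fun _ : E ↦ (1 : ℝ)) (f' := fun _ ↦ 0) (B := ContinuousLinearMap.lsmul ℝ ℝ) (v := e)
    (by simp) (by simpa only [ContinuousLinearMap.lsmul_apply, one_smul] using! hA.add hB)
    (by simpa using hΦ)
    (fun x _ ↦ by simpa [HasLineDerivAt] using hasDerivAt_const (0 : ℝ) (1 : ℝ))
    (fun x _ ↦ hasLineDerivAt_zonal e hg x)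
  simp only [ContinuousLinearMap.lsmul_apply, one_smul, zero_smul, integral_zero, neg_zero]
    at hzero
  rw [integral_add hA hB, hA', hB'] at hzero
  generalize Module.finrank ℝ E - 1 = d at hzero ⊢
  simp only [hq1, hq3] at hzero
  rw [integral_sub ((integrableOn_pow_mul_exp_neg (_ + 1)).const_mul 2)
    (integrableOn_pow_mul_exp_neg (_ + 2)), integral_const_mul, integral_pow_mul_exp_neg,
    integral_pow_mul_exp_neg, Nat.factorial_succ (d + 1)] at hzero
  rw [integral_sub (hint _ (by fun_prop)) (hint _ (by fun_prop)), integral_const_mul]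
  have hfac : (((d + 1).factorial : ℕ) : ℂ) ≠ 0 := by exact_mod_cast Nat.factorial_ne_zero _
  refine (mul_eq_zero.1 (Eq.trans ?_ hzero)).resolve_left hfac
  push_cast
  ring

end SphereIntegration

theorem ofReal_sub_mul_I_ne_zero (t : ℝ) {ε : ℝ} (hε : 0 < ε) : (t : ℂ) - ε * Complex.I ≠ 0 := by
  intro h
  have := congrArg Complex.im h
  simp at this
  exact hε.ne' this

theorem le_norm_ofReal_sub_mul_I (t : ℝ) {ε : ℝ} (hε : 0 < ε) :
    ε ≤ ‖(t : ℂ) - ε * Complex.I‖ := by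
  simpa [abs_of_pos hε] using Complex.abs_im_le_norm ((t : ℂ) - ε * Complex.I)

instance (n : ℕ) : IsFiniteMeasure (sphereMeasure n) := by
  unfold sphereMeasure
  infer_instance

theorem integrable_sphereMeasure_of_continuous {n : ℕ}
    {p : sphere (0 : EuclideanSpace ℝ (Fin (n + 1))) 1 → ℂ} (hp : Continuous p) :
    Integrable p (sphereMeasure n) :=
  hp.integrable_of_hasCompactSupport (.of_compactSpace _)

theorem continuous_zpow_sub_mul_I {X : Type*} [TopologicalSpace X] {f : X → ℝ} (hf : Continuous f)
    {ε : ℝ} (hε : 0 < ε) (m : ℤ) :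
    Continuous fun x ↦ ((f x : ℂ) - ε * Complex.I) ^ m :=
  Continuous.zpow₀ (by fun_prop) m fun x ↦ .inl (ofReal_sub_mul_I_ne_zero (f x) hε)

theorem integral_sphereMeasure_zpow_mul_eq_zero {n : ℕ} (hn : 1 ≤ n) {ε : ℝ} (hε : 0 < ε) :
    ∫ x : sphere (0 : EuclideanSpace ℝ (Fin (n + 1))) 1,
      (((x : EuclideanSpace ℝ (Fin (n + 1))) 0 : ℂ) - (ε : ℂ) * Complex.I) ^ (-(n : ℤ) - 1) *
        (1 - ε * Complex.I * ((x : EuclideanSpace ℝ (Fin (n + 1))) 0 : ℂ))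
      ∂(sphereMeasure n) = 0 := by
  have hg (t : ℝ) : HasDerivAt (fun t : ℝ ↦ ((t : ℂ) - ε * Complex.I) ^ (-(n : ℤ)))
      (((-(n : ℤ) : ℤ) : ℂ) * ((t : ℂ) - ε * Complex.I) ^ (-(n : ℤ) - 1)) t := by
    have h1 : HasDerivAt (fun t : ℝ ↦ (t : ℂ) - ε * Complex.I) 1 t :=
      (HasDerivAt.ofReal_comp (hasDerivAt_id t)).sub_const _
    have h2 := (hasDerivAt_zpow (-(n : ℤ)) _ (.inl (ofReal_sub_mul_I_ne_zero t hε))).comp t h1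
    rwa [mul_one] at h2
  have hdiv := integral_toSphere_divergence_eq_zero
    (volume : Measure (EuclideanSpace ℝ (Fin (n + 1)))) (EuclideanSpace.single 0 (1 : ℝ)) hg
    (continuous_const.mul (continuous_zpow_sub_mul_I continuous_id hε _))
  have hn0 : (-(n : ℂ)) ≠ 0 := by
    have : (n : ℂ) ≠ 0 := by exact_mod_cast (by omega : n ≠ 0)
    simpa using this
  refine (mul_eq_zero.1 (Eq.trans ?_ hdiv)).resolve_left hn0
  rw [← integral_const_mul]
  refine integral_congr_ae (.of_forall fun x ↦ ?_)
  have h0 := ofReal_sub_mul_I_ne_zero ((x : EuclideanSpace ℝ (Fin (n + 1))) 0) hε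
  simp only [EuclideanSpace.inner_single_left, PiLp.norm_single, finrank_euclideanSpace,
    Fintype.card_fin, Nat.add_sub_cancel]
  have hz : (((x : EuclideanSpace ℝ (Fin (n + 1))) 0 : ℂ) - ε * Complex.I) ^ (-(n : ℤ)) =
      (((x : EuclideanSpace ℝ (Fin (n + 1))) 0 : ℂ) - ε * Complex.I) ^ (-(n : ℤ) - 1) *
        (((x : EuclideanSpace ℝ (Fin (n + 1))) 0 : ℂ) - ε * Complex.I) := by
    rw [zpow_sub_one₀ h0, inv_mul_cancel_right₀ h0]
  simp only [map_one, one_mul, norm_one, one_pow]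
  rw [hz]
  push_cast
  ring

theorem hasDerivAt_integral_sphereMeasure {n : ℕ} {ε : ℝ} (hε : 0 < ε) :
    HasDerivAt
      (fun ε : ℝ ↦ ∫ x : sphere (0 : EuclideanSpace ℝ (Fin (n + 1))) 1,
        (((x : EuclideanSpace ℝ (Fin (n + 1))) 0 : ℂ) - (ε : ℂ) * Complex.I) ^ (-(n : ℤ))
        ∂(sphereMeasure n))
      (∫ x : sphere (0 : EuclideanSpace ℝ (Fin (n + 1))) 1, n * Complex.I *
        (((x : EuclideanSpace ℝ (Fin (n + 1))) 0 : ℂ) - (ε : ℂ) * Complex.I) ^ (-(n : ℤ) - 1)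
        ∂(sphereMeasure n)) ε := by
  have hc : Continuous fun x : sphere (0 : EuclideanSpace ℝ (Fin (n + 1))) 1 ↦
      (x : EuclideanSpace ℝ (Fin (n + 1))) 0 := by fun_prop
  refine (hasDerivAt_integral_of_dominated_loc_of_deriv_le (s := Ioi (ε / 2))
    (μ := sphereMeasure n) (bound := fun _ ↦ n * (ε / 2) ^ (-(n : ℤ) - 1))
    (Ioi_mem_nhds (half_lt_self hε)) ?_ ?_ ?_ ?_ (integrable_const _) ?_
    (F' := fun ε x ↦ n * Complex.I *
        (((x : EuclideanSpace ℝ (Fin (n + 1))) 0 : ℂ) - (ε : ℂ) * Complex.I) ^ (-(n : ℤ) - 1))).2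
  · filter_upwards [Ioi_mem_nhds hε] with δ hδ
    exact (integrable_sphereMeasure_of_continuous
      (continuous_zpow_sub_mul_I hc hδ _)).aestronglyMeasurable
  · exact integrable_sphereMeasure_of_continuous (continuous_zpow_sub_mul_I hc hε _)
  · exact (integrable_sphereMeasure_of_continuous
      (continuous_const.mul (continuous_zpow_sub_mul_I hc hε _))).aestronglyMeasurable
  · refine .of_forall fun x δ hδ ↦ ?_
    have hδ' : ε / 2 < δ := hδ
    have hle := le_norm_ofReal_sub_mul_I ((x : EuclideanSpace ℝ (Fin (n + 1))) 0)
      (by linarith : 0 < δ)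
    have hexp : -(n : ℤ) - 1 = -((n + 1 : ℕ) : ℤ) := by push_cast; ring
    rw [norm_mul, norm_mul, Complex.norm_I, mul_one, Complex.norm_natCast, norm_zpow, hexp,
      zpow_neg, zpow_neg, zpow_natCast, zpow_natCast]
    gcongr
    linarith
  · refine .of_forall fun x δ hδ ↦ ?_
    have hδ' : ε / 2 < δ := hδ
    have h0 := ofReal_sub_mul_I_ne_zero ((x : EuclideanSpace ℝ (Fin (n + 1))) 0)
      (by linarith : 0 < δ)
    have h1 : HasDerivAt (fun δ : ℝ ↦
        (((x : EuclideanSpace ℝ (Fin (n + 1))) 0 : ℂ) - (δ : ℂ) * Complex.I)) (-Complex.I) δ := by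
      simpa using ((HasDerivAt.ofReal_comp (hasDerivAt_id δ)).mul_const Complex.I).const_sub
        ((x : EuclideanSpace ℝ (Fin (n + 1))) 0 : ℂ)
    convert! (hasDerivAt_zpow (-(n : ℤ)) _ (.inl h0)).comp δ h1 using 1
    push_cast
    ring

theorem tendsto_sqrt_div_sub_mul_I (t : ℝ) :
    Tendsto (fun ε : ℝ ↦ ((√(1 + ε ^ 2) : ℝ) : ℂ) / (t - ε * Complex.I)) atTop (𝓝 Complex.I) := by
  have hnum : Tendsto (fun ε : ℝ ↦ √((ε⁻¹) ^ 2 + 1)) atTop (𝓝 1) := by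
    have := ((tendsto_inv_atTop_zero (𝕜 := ℝ)).pow 2).add_const 1 |>.sqrt
    simpa using this
  have hden : Tendsto (fun ε : ℝ ↦ (t : ℂ) * (ε⁻¹ : ℝ) - Complex.I) atTop
      (𝓝 (-Complex.I)) := by
    have := ((Complex.continuous_ofReal.tendsto _).comp
      (tendsto_inv_atTop_zero (𝕜 := ℝ))).const_mul (t : ℂ) |>.sub_const Complex.I
    simpa using this
  have h := ((Complex.continuous_ofReal.tendsto _).comp hnum).div hden (by simp)
  have hI : ((1 : ℝ) : ℂ) / (-Complex.I) = Complex.I := by simp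
  rw [hI] at h
  refine h.congr' ?_
  filter_upwards [eventually_gt_atTop 0] with ε hε
  have hs : √(1 + ε ^ 2) = ε * √((ε⁻¹) ^ 2 + 1) := by
    rw [← Real.sqrt_sq hε.le, ← Real.sqrt_mul (by positivity), Real.sqrt_sq hε.le]
    congr 1
    field_simp
  have hd : (t : ℂ) - ε * Complex.I = ε * (t * (ε⁻¹ : ℝ) - Complex.I) := by
    have : (ε : ℂ) ≠ 0 := by exact_mod_cast hε.ne'
    push_cast
    field_simp
  have hε' : (ε : ℂ) ≠ 0 := by exact_mod_cast hε.ne'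
  rw [hs, hd, Complex.ofReal_mul, mul_div_mul_left _ _ hε']
  rfl

theorem integral_sphereMeasure_zpow_mul_sqrt_pow {n : ℕ} (hn : 1 ≤ n) {ε : ℝ} (hε : 0 < ε) :
    (∫ x : sphere (0 : EuclideanSpace ℝ (Fin (n + 1))) 1,
      (((x : EuclideanSpace ℝ (Fin (n + 1))) 0 : ℂ) - (ε : ℂ) * Complex.I) ^ (-(n : ℤ))
      ∂(sphereMeasure n)) * ((√(1 + ε ^ 2) : ℝ) : ℂ) ^ n =
    Complex.I ^ n * ((sphereMeasure n Set.univ).toReal : ℂ) := by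
  have hc : Continuous fun x : sphere (0 : EuclideanSpace ℝ (Fin (n + 1))) 1 ↦
      (x : EuclideanSpace ℝ (Fin (n + 1))) 0 := by fun_prop
  set F : ℝ → ℂ := fun ε : ℝ ↦ ∫ x : sphere (0 : EuclideanSpace ℝ (Fin (n + 1))) 1,
      (((x : EuclideanSpace ℝ (Fin (n + 1))) 0 : ℂ) - (ε : ℂ) * Complex.I) ^ (-(n : ℤ))
      ∂(sphereMeasure n) with hF
  have hderiv (δ : ℝ) (hδ : 0 < δ) :
      HasDerivAt (fun δ : ℝ ↦ F δ * ((√(1 + δ ^ 2) : ℝ) : ℂ) ^ n) 0 δ := by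
    have hpos : 0 < 1 + δ ^ 2 := by positivity
    have hs : HasDerivAt (fun δ : ℝ ↦ √(1 + δ ^ 2)) (δ / √(1 + δ ^ 2)) δ := by
      convert! (((hasDerivAt_id δ).fun_pow 2).const_add 1).sqrt hpos.ne' using 1
      simp
      field_simp
    have hs0 : ((√(1 + δ ^ 2) : ℝ) : ℂ) ≠ 0 := by exact_mod_cast (Real.sqrt_pos.2 hpos).ne'
    have hs2 : ((√(1 + δ ^ 2) : ℝ) : ℂ) ^ 2 = 1 + δ ^ 2 := by
      exact_mod_cast Real.sq_sqrt hpos.le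
    obtain ⟨J, hJ, hode⟩ : ∃ J, HasDerivAt F J δ ∧
        (1 + (δ : ℂ) ^ 2) * J + n * δ * F δ = 0 := by
      refine ⟨_, hasDerivAt_integral_sphereMeasure hδ, ?_⟩
      rw [hF, ← integral_const_mul, ← integral_const_mul, ← integral_add]
      · rw [← mul_zero (n * Complex.I : ℂ), ← integral_sphereMeasure_zpow_mul_eq_zero hn hδ,
          ← integral_const_mul]
        refine integral_congr_ae (.of_forall fun x ↦ ?_)
        have h0 := ofReal_sub_mul_I_ne_zero ((x : EuclideanSpace ℝ (Fin (n + 1))) 0) hδ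
        simp only [zpow_sub_one₀ h0]
        field_simp
        ring_nf
        simp only [Complex.I_sq]
        ring
      · exact integrable_sphereMeasure_of_continuous
          (continuous_const.mul (continuous_const.mul (continuous_zpow_sub_mul_I hc hδ _)))
      · exact integrable_sphereMeasure_of_continuous
          (continuous_const.mul (continuous_zpow_sub_mul_I hc hδ _))
    convert! hJ.fun_mul (hs.ofReal_comp.fun_pow n) using 1
    obtain ⟨m, rfl⟩ : ∃ m, n = m + 1 := ⟨n - 1, by omega⟩
    rw [← hs2] at hode
    generalize F δ = Fδ at hode ⊢
    simp only [Nat.add_sub_cancel, Complex.ofReal_div]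
    field_simp
    linear_combination -((√(1 + δ ^ 2) : ℝ) : ℂ) ^ m * hode
  have hconst (δ : ℝ) (hδ : 0 < δ) : F δ * ((√(1 + δ ^ 2) : ℝ) : ℂ) ^ n =
      F ε * ((√(1 + ε ^ 2) : ℝ) : ℂ) ^ n :=
    isOpen_Ioi.is_const_of_deriv_eq_zero isPreconnected_Ioi
      (fun y hy ↦ (hderiv y hy).differentiableAt.differentiableWithinAt)
      (fun y hy ↦ (hderiv y hy).deriv) hδ hε
  have hlim : Tendsto (fun δ : ℝ ↦ F δ * ((√(1 + δ ^ 2) : ℝ) : ℂ) ^ n) atTop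
      (𝓝 (∫ _ : sphere (0 : EuclideanSpace ℝ (Fin (n + 1))) 1, Complex.I ^ n
        ∂(sphereMeasure n))) := by
    simp only [hF, ← integral_mul_const]
    refine tendsto_integral_filter_of_dominated_convergence (fun _ ↦ 2 ^ n) ?_ ?_
      (integrable_const _) ?_
    · filter_upwards [eventually_gt_atTop 0] with δ hδ
      exact (integrable_sphereMeasure_of_continuous
        ((continuous_zpow_sub_mul_I hc hδ _).mul continuous_const)).aestronglyMeasurable
    · filter_upwards [eventually_ge_atTop 1] with δ hδ
      refine .of_forall fun x ↦ ?_
      have hδ0 : 0 < δ := by linarith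
      have hle := le_norm_ofReal_sub_mul_I ((x : EuclideanSpace ℝ (Fin (n + 1))) 0) hδ0
      have hsq : √(1 + δ ^ 2) ≤ 2 * δ := Real.sqrt_le_iff.2 ⟨by linarith, by nlinarith⟩
      rw [zpow_neg, zpow_natCast, ← inv_pow, ← mul_pow, norm_pow, norm_mul, norm_inv,
        Complex.norm_real, Real.norm_of_nonneg (Real.sqrt_nonneg _)]
      gcongr
      rw [inv_mul_le_iff₀ (by linarith)]
      linarith
    · refine .of_forall fun x ↦ ?_
      refine ((tendsto_sqrt_div_sub_mul_I
        ((x : EuclideanSpace ℝ (Fin (n + 1))) 0)).pow n).congr fun δ ↦ ?_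
      rw [zpow_neg, zpow_natCast, div_pow, div_eq_inv_mul]
  have hlim' := hlim.congr' (f₂ := fun _ ↦ F ε * ((√(1 + ε ^ 2) : ℝ) : ℂ) ^ n)
    (by filter_upwards [eventually_gt_atTop 0] with δ hδ using hconst δ hδ)
  rw [tendsto_nhds_unique tendsto_const_nhds hlim', integral_const, Complex.real_smul,
    mul_comm]
  rfl

/-- **Total volume of the double hyperbolic space** (Theorem 1.1, hemisphere model):
`V_n(DHⁿ) = lim_{ε → 0⁺} ∫_{Sⁿ} (x₀ - εi)^{-n} dσ(x) = iⁿ · σ(Sⁿ)`. -/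
theorem total_volume_double_hyperbolic (n : ℕ) (hn : 1 ≤ n) :
    Tendsto
      (fun ε : ℝ =>
        ∫ x : sphere (0 : EuclideanSpace ℝ (Fin (n + 1))) 1,
          (((x : EuclideanSpace ℝ (Fin (n + 1))) 0 : ℂ) - (ε : ℂ) * Complex.I) ^ (-(n : ℤ))
          ∂(sphereMeasure n))
      (nhdsWithin 0 (Set.Ioi 0))
      (nhds (Complex.I ^ n * ((sphereMeasure n Set.univ).toReal : ℂ))) := by
  have hs : Tendsto (fun ε : ℝ ↦ ((√(1 + ε ^ 2) : ℝ) : ℂ) ^ n) (𝓝[>] 0) (𝓝 1) := by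
    have : Continuous fun ε : ℝ ↦ ((√(1 + ε ^ 2) : ℝ) : ℂ) ^ n := by fun_prop
    simpa using (this.tendsto 0).mono_left nhdsWithin_le_nhds
  have h := (tendsto_const_nhds
    (x := Complex.I ^ n * ((sphereMeasure n Set.univ).toReal : ℂ))).div hs one_ne_zero
  rw [div_one] at h
  refine h.congr' ?_
  filter_upwards [self_mem_nhdsWithin] with ε hε
  have hs0 : ((√(1 + ε ^ 2) : ℝ) : ℂ) ^ n ≠ 0 :=
    pow_ne_zero _ (by exact_mod_cast (Real.sqrt_pos.2 (by positivity : 0 < 1 + ε ^ 2)).ne')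
  exact ((eq_div_iff hs0).2 (integral_sphereMeasure_zpow_mul_sqrt_pow hn hε)).symm
end

section
/- For every integer n ≥ 2 and every θ with 0 ≤ θ ≤ 2π, let L_θ = {x ∈ Sⁿ : the last two coordinates can be written x_{n−1} = ρ cos φ and x_n = ρ sin φ for some ρ ≥ 0 and 0 ≤ φ ≤ θ}. Then the limit as ε → 0⁺ of ∫_{L_θ} (x₀ − εi)^{−n} dσ(x) exists and equals (θ/(2π)) · iⁿ · σ(Sⁿ). (This is the volume of the n-dimensional lune L^n_θ in the double hyperbolic space, proved via the Schläfli differential formula in the proof of Theorem 1.1.) -/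
open MeasureTheory Filter Metric

/-- The lune `L_θ ⊆ Sⁿ`: the set of points whose last two coordinates can be written as
`x_{n-1} = ρ cos φ`, `x_n = ρ sin φ` with `ρ ≥ 0` and `0 ≤ φ ≤ θ`. -/
def lune (n : ℕ) (θ : ℝ) : Set (sphere (0 : EuclideanSpace ℝ (Fin (n + 1))) 1) :=
  {x | ∃ ρ φ : ℝ, 0 ≤ ρ ∧ 0 ≤ φ ∧ φ ≤ θ ∧
    (x : EuclideanSpace ℝ (Fin (n + 1))) ⟨n - 1, by omega⟩ = ρ * Real.cos φ ∧
    (x : EuclideanSpace ℝ (Fin (n + 1))) ⟨n, by omega⟩ = ρ * Real.sin φ}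

/-- The rotation by the angle `t` in the plane spanned by the coordinates `i ≠ j`. -/
noncomputable def planeRotation {ι : Type*} [Fintype ι] [DecidableEq ι] {i j : ι} (hij : i ≠ j)
    (t : ℝ) : EuclideanSpace ℝ ι →ₗᵢ[ℝ] EuclideanSpace ℝ ι where
  toFun x := WithLp.toLp 2 fun k =>
    if k = i then x i * Real.cos t - x j * Real.sin t
    else if k = j then x i * Real.sin t + x j * Real.cos t else x k
  map_add' x y := by
    ext k
    simp only [PiLp.add_apply]
    split_ifs <;> ring
  map_smul' c x := by
    ext k
    simp only [PiLp.smul_apply, smul_eq_mul, RingHom.id_apply]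
    split_ifs <;> ring
  norm_map' x := by
    simp only [LinearMap.coe_mk, AddHom.coe_mk, EuclideanSpace.norm_eq, Real.norm_eq_abs, sq_abs]
    congr 1
    have hj : j ∈ Finset.univ.erase i := by simp [hij.symm]
    rw [← Finset.add_sum_erase _ _ (Finset.mem_univ i), ← Finset.add_sum_erase _ _ hj,
      ← Finset.add_sum_erase _ _ (Finset.mem_univ i), ← Finset.add_sum_erase _ _ hj]
    rw [Finset.sum_congr rfl (g := fun k => x k ^ 2)]
    · simp only [if_true, hij.symm, if_false]
      linear_combination (x i ^ 2 + x j ^ 2) * Real.sin_sq_add_cos_sq t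
    · intro k hk
      simp only [Finset.mem_erase] at hk
      simp [hk.1, hk.2.1]

/-- The self-map of the unit sphere induced by a linear isometry. -/
def LinearIsometry.sphereMap {E : Type*} [NormedAddCommGroup E] [NormedSpace ℝ E]
    (T : E →ₗᵢ[ℝ] E) (x : sphere (0 : E) 1) : sphere (0 : E) 1 :=
  ⟨T x, by simp⟩

open scoped Pointwise in
theorem LinearIsometry.measurePreserving_sphereMap {E : Type*} [NormedAddCommGroup E]
    [InnerProductSpace ℝ E] [FiniteDimensional ℝ E] [MeasurableSpace E] [BorelSpace E]
    (T : E →ₗᵢ[ℝ] E) :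
    MeasurePreserving T.sphereMap (volume : Measure E).toSphere (volume : Measure E).toSphere := by
  have hc : Continuous T.sphereMap := by unfold LinearIsometry.sphereMap; fun_prop
  refine ⟨hc.measurable, ?_⟩
  ext s hs
  rw [Measure.map_apply hc.measurable hs, Measure.toSphere_apply' _ hs,
    Measure.toSphere_apply' _ (hc.measurable hs)]
  congr 1
  let e : E ≃ₗᵢ[ℝ] E := T.toLinearIsometryEquiv rfl
  rw [← e.measurePreserving.measure_preimage_equiv (f := e.toHomeomorph.toMeasurableEquiv)
    (Set.Ioo (0 : ℝ) 1 • (Subtype.val '' s))]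
  congr 1
  ext y
  simp only [Set.mem_smul, Set.mem_image, Subtype.exists, Set.mem_preimage, mem_sphere_zero_iff_norm]
  constructor
  · rintro ⟨r, hr, _, ⟨x, hx, hxs, rfl⟩, rfl⟩
    exact ⟨r, hr, T x, ⟨T x, by simpa using hx, hxs, rfl⟩, (e.map_smul r x).symm⟩
  · rintro ⟨r, hr, _, ⟨x, hx, hxs, rfl⟩, h⟩
    refine ⟨r, hr, e.symm x, ⟨e.symm x, by simpa using hx, ?_, rfl⟩, ?_⟩
    · have : T (e.symm x) = x := e.apply_symm_apply x
      simpa [LinearIsometry.sphereMap, this] using hxs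
    · apply e.injective
      rw [e.map_smul, e.apply_symm_apply]
      exact h

theorem hasDerivAt_integral_of_compactSpace {X : Type*} [TopologicalSpace X] [CompactSpace X]
    [SecondCountableTopology X] [MeasurableSpace X] [OpensMeasurableSpace X] (μ : Measure X)
    [IsFiniteMeasure μ] {F F' : ℝ → X → ℂ} (hF : Continuous (Function.uncurry F))
    (hF' : Continuous (Function.uncurry F')) (h : ∀ x t, HasDerivAt (fun t => F t x) (F' t x) t)
    (t : ℝ) : HasDerivAt (fun t => ∫ x, F t x ∂μ) (∫ x, F' t x ∂μ) t := by
  obtain ⟨C, hC⟩ := ((isCompact_closedBall t 1).prod isCompact_univ).exists_bound_of_continuousOn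
    (f := Function.uncurry F') (s := closedBall t 1 ×ˢ (Set.univ : Set X)) hF'.continuousOn
  have hFt (t : ℝ) : Continuous (F t) := by
    exact hF.comp (Continuous.prodMk_right t)
  have hFt' (t : ℝ) : Continuous (F' t) := by
    exact hF'.comp (Continuous.prodMk_right t)
  refine (hasDerivAt_integral_of_dominated_loc_of_deriv_le (bound := fun _ => C)
    (closedBall_mem_nhds t one_pos) (Eventually.of_forall fun s => (hFt s).aestronglyMeasurable)
    ?_ (hFt' t).aestronglyMeasurable ?_ (integrable_const C) ?_).2
  · exact (hFt t).integrable_of_hasCompactSupport (HasCompactSupport.of_compactSpace _)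
  · exact Eventually.of_forall fun x s hs => hC (s, x) ⟨hs, Set.mem_univ _⟩
  · exact Eventually.of_forall fun x s _ => h x s

theorem norm_one_add_I_mul_ge (y : ℝ) : 1 ≤ ‖(1 + Complex.I * y : ℂ)‖ := by
  simpa using Complex.abs_re_le_norm (1 + Complex.I * y : ℂ)

theorem one_add_I_mul_ne_zero (y : ℝ) : (1 + Complex.I * y : ℂ) ≠ 0 := by
  rw [← norm_pos_iff]
  linarith [norm_one_add_I_mul_ge y]

theorem hasDerivAt_inv_one_add_I_mul_pow (n : ℕ) {f : ℝ → ℝ} {f' t : ℝ} (hf : HasDerivAt f f' t) :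
    HasDerivAt (fun t => ((1 + Complex.I * f t : ℂ) ^ n)⁻¹)
      (-n * Complex.I * f' * ((1 + Complex.I * f t : ℂ) ^ (n + 1))⁻¹) t := by
  have h0 := one_add_I_mul_ne_zero (f t)
  refine ((((hf.ofReal_comp.const_mul Complex.I).const_add 1).fun_pow n).fun_inv
    (pow_ne_zero n h0)).congr_deriv ?_
  rcases n with _ | n
  · simp
  · simp only [Nat.add_sub_cancel]
    field_simp
    ring

theorem Continuous.inv_one_add_I_mul_pow {X : Type*} [TopologicalSpace X] (n : ℕ) {f : X → ℝ}
    (hf : Continuous f) : Continuous fun x => ((1 + Complex.I * f x : ℂ) ^ n)⁻¹ := by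
  refine Continuous.inv₀ (by fun_prop) fun x => pow_ne_zero n (one_add_I_mul_ne_zero _)

theorem Continuous.integrable_of_compactSpace {X : Type*} [TopologicalSpace X] [CompactSpace X]
    [SecondCountableTopology X] [MeasurableSpace X] [OpensMeasurableSpace X] {μ : Measure X}
    [IsFiniteMeasure μ] {f : X → ℂ} (hf : Continuous f) : Integrable f μ :=
  hf.integrable_of_hasCompactSupport (HasCompactSupport.of_compactSpace _)

/-- The infinitesimal form of the invariance of the surface measure under rotations in the plane of
the coordinates `i` and `j`, applied to `x ↦ x j * (1 + I * w * x i) ^ (-n)`. -/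
theorem integral_sphere_rotation_deriv {ι : Type*} [Fintype ι] [DecidableEq ι] {i j : ι}
    (hij : i ≠ j) (n : ℕ) (w : ℝ) :
    ∫ x : sphere (0 : EuclideanSpace ℝ ι) 1,
      ((x.1 i : ℂ) * ((1 + Complex.I * (w * x.1 i : ℝ) : ℂ) ^ n)⁻¹ +
        n * Complex.I * w * (x.1 j : ℂ) ^ 2 * ((1 + Complex.I * (w * x.1 i : ℝ) : ℂ) ^ (n + 1))⁻¹)
      ∂(volume : Measure (EuclideanSpace ℝ ι)).toSphere = 0 := by
  set μ := (volume : Measure (EuclideanSpace ℝ ι)).toSphere with hμ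
  let u (t : ℝ) (x : sphere (0 : EuclideanSpace ℝ ι) 1) : ℝ :=
    x.1 i * Real.cos t - x.1 j * Real.sin t
  let v (t : ℝ) (x : sphere (0 : EuclideanSpace ℝ ι) 1) : ℝ :=
    x.1 i * Real.sin t + x.1 j * Real.cos t
  have hu : Continuous (Function.uncurry u) := by
    simp only [u, Function.uncurry_def]; fun_prop
  have hv : Continuous (Function.uncurry v) := by
    simp only [v, Function.uncurry_def]; fun_prop
  let F (t : ℝ) (x : sphere (0 : EuclideanSpace ℝ ι) 1) : ℂ :=
    v t x * ((1 + Complex.I * (w * u t x : ℝ) : ℂ) ^ n)⁻¹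
  let F' (t : ℝ) (x : sphere (0 : EuclideanSpace ℝ ι) 1) : ℂ :=
    u t x * ((1 + Complex.I * (w * u t x : ℝ) : ℂ) ^ n)⁻¹ +
        n * Complex.I * w * (v t x : ℂ) ^ 2 * ((1 + Complex.I * (w * u t x : ℝ) : ℂ) ^ (n + 1))⁻¹
  have hD (m : ℕ) := (hu.const_mul w).inv_one_add_I_mul_pow m
  have hF : Continuous (Function.uncurry F) :=
    (Complex.continuous_ofReal.comp hv).mul (hD n)
  have hF' : Continuous (Function.uncurry F') :=
    ((Complex.continuous_ofReal.comp hu).mul (hD n)).add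
      ((((Complex.continuous_ofReal.comp hv).pow 2).const_mul _).mul (hD (n + 1)))
  have hderiv (x) (t : ℝ) : HasDerivAt (fun t => F t x) (F' t x) t := by
    have h1 : HasDerivAt (fun t => u t x) (-v t x) t := by
      refine (((Real.hasDerivAt_cos t).const_mul (x.1 i)).fun_sub
        ((Real.hasDerivAt_sin t).const_mul (x.1 j))).congr_deriv ?_
      simp only [v]; ring
    have h2 : HasDerivAt (fun t => v t x) (u t x) t := by
      refine (((Real.hasDerivAt_sin t).const_mul (x.1 i)).fun_add
        ((Real.hasDerivAt_cos t).const_mul (x.1 j))).congr_deriv ?_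
      simp only [u]; ring
    refine (h2.ofReal_comp.fun_mul
      (hasDerivAt_inv_one_add_I_mul_pow n (h1.const_mul w))).congr_deriv ?_
    simp only [F']
    push_cast
    ring
  have hconst (t : ℝ) : ∫ x, F t x ∂μ = ∫ x, F 0 x ∂μ := by
    have hmp := (planeRotation hij t).measurePreserving_sphereMap
    have hF0 : Continuous (F 0) := hF.comp (Continuous.prodMk_right 0)
    rw [← hμ] at hmp
    nth_rw 2 [← hmp.map_eq]
    rw [integral_map hmp.measurable.aemeasurable hF0.aestronglyMeasurable]
    refine integral_congr_ae (Eventually.of_forall fun x => ?_)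
    simp [F, u, v, LinearIsometry.sphereMap, planeRotation, hij.symm]
  have h := hasDerivAt_integral_of_compactSpace μ hF hF' hderiv 0
  simp only [hconst] at h
  have h0 := h.unique (hasDerivAt_const 0 _)
  simpa [F', u, v] using h0

theorem hasDerivAt_integral_sphere_inv_pow (n : ℕ) (w : ℝ) :
    HasDerivAt (fun w : ℝ => ∫ x, ((1 + Complex.I * (w * x.1 0 : ℝ) : ℂ) ^ n)⁻¹ ∂sphereMeasure n)
      (∫ x, (-n * Complex.I * x.1 0 * ((1 + Complex.I * (w * x.1 0 : ℝ) : ℂ) ^ (n + 1))⁻¹)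
        ∂sphereMeasure n) w := by
  have : IsFiniteMeasure (sphereMeasure n) := by unfold sphereMeasure; infer_instance
  let F (w : ℝ) (x : sphere (0 : EuclideanSpace ℝ (Fin (n + 1))) 1) : ℂ :=
    ((1 + Complex.I * (w * x.1 0 : ℝ) : ℂ) ^ n)⁻¹
  let F' (w : ℝ) (x : sphere (0 : EuclideanSpace ℝ (Fin (n + 1))) 1) : ℂ :=
    -n * Complex.I * x.1 0 * ((1 + Complex.I * (w * x.1 0 : ℝ) : ℂ) ^ (n + 1))⁻¹
  have hu : Continuous fun p : ℝ × sphere (0 : EuclideanSpace ℝ (Fin (n + 1))) 1 =>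
    p.1 * p.2.1 0 := by fun_prop
  have hx : Continuous fun p : ℝ × sphere (0 : EuclideanSpace ℝ (Fin (n + 1))) 1 =>
    -n * Complex.I * (p.2.1 0 : ℂ) := by fun_prop
  have hF : Continuous (Function.uncurry F) := hu.inv_one_add_I_mul_pow n
  have hF' : Continuous (Function.uncurry F') := hx.mul (hu.inv_one_add_I_mul_pow (n + 1))
  have h (x : sphere (0 : EuclideanSpace ℝ (Fin (n + 1))) 1) (t : ℝ) :
      HasDerivAt (fun t => F t x) (F' t x) t := by
    simpa [F, F'] using hasDerivAt_inv_one_add_I_mul_pow n ((hasDerivAt_id t).mul_const (x.1 0))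
  exact hasDerivAt_integral_of_compactSpace _ hF hF' h w

theorem integral_sphere_add_I_mul (n : ℕ) (hn : n ≠ 0) (w : ℝ) :
    ∫ x, (((x.1 0 : ℝ) + Complex.I * w) * ((1 + Complex.I * (w * x.1 0 : ℝ) : ℂ) ^ (n + 1))⁻¹)
      ∂sphereMeasure n = 0 := by
  have h (j : Fin n) := integral_sphere_rotation_deriv (Fin.succ_ne_zero j).symm n w
  have hs := Finset.sum_congr rfl (s₁ := Finset.univ) fun j _ => h j
  have hx : Continuous fun x : sphere (0 : EuclideanSpace ℝ (Fin (n + 1))) 1 => w * x.1 0 := by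
    fun_prop
  rw [← integral_finsetSum, Finset.sum_const_zero] at hs
  · rw [← mul_right_inj' (Nat.cast_ne_zero.2 hn : (n : ℂ) ≠ 0), mul_zero, ← integral_const_mul,
      ← hs]
    refine integral_congr_ae (Eventually.of_forall fun x => ?_)
    have hx : ∑ k : Fin n, (x.1 k.succ : ℂ) ^ 2 = 1 - (x.1 0 : ℂ) ^ 2 := by
      have h1 := EuclideanSpace.real_norm_sq_eq x.1
      rw [mem_sphere_zero_iff_norm.1 x.2, one_pow, Fin.sum_univ_succ] at h1
      rw [eq_sub_iff_add_eq']
      exact_mod_cast h1.symm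
    have h0 := one_add_I_mul_ne_zero (w * x.1 0)
    simp only [Finset.sum_add_distrib, ← Finset.sum_mul, ← Finset.mul_sum, hx]
    simp only [Finset.sum_const, Finset.card_univ, Fintype.card_fin, nsmul_eq_mul]
    field_simp
    push_cast
    ring
  · intro j _
    refine Continuous.integrable_of_compactSpace (Continuous.add
      (Continuous.mul (by fun_prop) (hx.inv_one_add_I_mul_pow n))
      (Continuous.mul (by fun_prop) (hx.inv_one_add_I_mul_pow (n + 1))))

theorem integral_sphere_inv_one_add_I_mul_pow (n : ℕ) (hn : n ≠ 0) (w : ℝ) :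
    (∫ x, ((1 + Complex.I * (w * x.1 0 : ℝ) : ℂ) ^ n)⁻¹ ∂sphereMeasure n) * √(1 + w ^ 2) ^ n =
      (sphereMeasure n Set.univ).toReal := by
  set A : ℝ → ℂ := fun w => ∫ x, ((1 + Complex.I * (w * x.1 0 : ℝ) : ℂ) ^ n)⁻¹ ∂sphereMeasure n
  have hode (w : ℝ) : (1 + w ^ 2) * deriv A w = - n * w * A w := by
    rw [(hasDerivAt_integral_sphere_inv_pow n w).deriv, ← sub_eq_zero]
    simp only [A]
    have hx : Continuous fun x : sphere (0 : EuclideanSpace ℝ (Fin (n + 1))) 1 => w * x.1 0 := by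
      fun_prop
    have : IsFiniteMeasure (sphereMeasure n) := by unfold sphereMeasure; infer_instance
    rw [← integral_const_mul, ← integral_const_mul, ← integral_sub]
    · trans ∫ x, (-n * Complex.I) * (((x.1 0 : ℝ) + Complex.I * w) *
        ((1 + Complex.I * (w * x.1 0 : ℝ) : ℂ) ^ (n + 1))⁻¹) ∂sphereMeasure n
      · refine integral_congr_ae (Eventually.of_forall fun x => ?_)
        have h0 := one_add_I_mul_ne_zero (w * x.1 0)
        simp only
        field_simp
        push_cast
        linear_combination (w * (1 + w * Complex.I * x.1 0) ^ n) * Complex.I_sq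
      · rw [integral_const_mul, integral_sphere_add_I_mul n hn, mul_zero]
    · exact Continuous.integrable_of_compactSpace (Continuous.mul (by fun_prop)
        (Continuous.mul (by fun_prop) (hx.inv_one_add_I_mul_pow (n + 1))))
    · exact Continuous.integrable_of_compactSpace
        (Continuous.mul (by fun_prop) (hx.inv_one_add_I_mul_pow n))
  have hd (w : ℝ) : HasDerivAt (fun w => A w * ((√(1 + w ^ 2) : ℝ) : ℂ) ^ n) 0 w := by
    have hpos : 0 < 1 + w ^ 2 := by positivity
    have hs : HasDerivAt (fun w : ℝ => √(1 + w ^ 2)) (w / √(1 + w ^ 2)) w := by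
      refine ((((hasDerivAt_id' w).fun_pow 2).const_add 1).sqrt hpos.ne').congr_deriv ?_
      simp
      field_simp
    have hA : HasDerivAt A (deriv A w) w :=
      (hasDerivAt_integral_sphere_inv_pow n w).differentiableAt.hasDerivAt
    refine (hA.fun_mul (hs.ofReal_comp.fun_pow n)).congr_deriv ?_
    have hsq : ((√(1 + w ^ 2) : ℝ) : ℂ) ^ 2 = 1 + w ^ 2 := by
      exact_mod_cast Real.sq_sqrt hpos.le
    have hne : ((√(1 + w ^ 2) : ℝ) : ℂ) ≠ 0 := by
      exact_mod_cast (Real.sqrt_pos.2 hpos).ne'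
    obtain ⟨m, rfl⟩ := Nat.exists_eq_succ_of_ne_zero hn
    have := hode w
    rw [← hsq] at this
    push_cast at this ⊢
    simp only [Nat.succ_eq_add_one]
    field_simp
    linear_combination ((√(1 + w ^ 2) : ℝ) : ℂ) ^ m * this
  have hc := is_const_of_deriv_eq_zero (fun w => (hd w).differentiableAt)
    (fun w => (hd w).deriv) w 0
  rw [hc]
  simp [A, Measure.real]

/-- The closed sector of angle `θ` in the complex plane, starting at the positive real axis. -/
def complexSector (θ : ℝ) : Set ℂ :=
  {z | ∃ ρ φ : ℝ, 0 ≤ ρ ∧ 0 ≤ φ ∧ φ ≤ θ ∧ z.re = ρ * Real.cos φ ∧ z.im = ρ * Real.sin φ}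

theorem measurableSet_complexSector (θ : ℝ) : MeasurableSet (complexSector θ) := by
  have h : complexSector θ = ⋃ k : ℕ,
      (fun p : ℝ × ℝ => (⟨p.1 * Real.cos p.2, p.1 * Real.sin p.2⟩ : ℂ)) ''
      (Set.Icc 0 (k : ℝ) ×ˢ Set.Icc 0 θ) := by
    ext z
    simp only [complexSector, Set.mem_ofPred_eq, Set.mem_iUnion, Set.mem_image, Prod.exists,
      Set.mem_prod, Set.mem_Icc]
    constructor
    · rintro ⟨ρ, φ, hρ, h0, h1, hre, him⟩
      obtain ⟨k, hk⟩ := exists_nat_ge ρ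
      exact ⟨k, ρ, φ, ⟨⟨hρ, hk⟩, h0, h1⟩, Complex.ext hre.symm him.symm⟩
    · rintro ⟨k, ρ, φ, ⟨⟨hρ, -⟩, h0, h1⟩, rfl⟩
      exact ⟨ρ, φ, hρ, h0, h1, rfl, rfl⟩
  have hc : Continuous fun p : ℝ × ℝ => (⟨p.1 * Real.cos p.2, p.1 * Real.sin p.2⟩ : ℂ) :=
    Complex.equivRealProdCLM.symm.continuous.comp
      (f := fun p : ℝ × ℝ => (p.1 * Real.cos p.2, p.1 * Real.sin p.2)) (by fun_prop)
  rw [h]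
  exact MeasurableSet.iUnion fun k =>
    ((isCompact_Icc.prod isCompact_Icc).image hc).isClosed.measurableSet

theorem mul_exp_mem_complexSector_iff {θ r u : ℝ} (hθ : θ ≤ 2 * Real.pi) (hr : 0 < r) (hu0 : 0 < u)
    (hu : u < 2 * Real.pi) : (r * Complex.exp (u * Complex.I) : ℂ) ∈ complexSector θ ↔ u ≤ θ := by
  have hre : (r * Complex.exp (u * Complex.I) : ℂ).re = r * Real.cos u := by
    simp [Complex.exp_ofReal_mul_I_re]
  have him : (r * Complex.exp (u * Complex.I) : ℂ).im = r * Real.sin u := by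
    simp [Complex.exp_ofReal_mul_I_im]
  simp only [complexSector, Set.mem_ofPred_eq, hre, him]
  constructor
  · rintro ⟨ρ, φ, hρ, h0, h1, hc, hs⟩
    have hρr : r = ρ := by
      rw [← sq_eq_sq₀ hr.le hρ]
      linear_combination (-r ^ 2) * Real.sin_sq_add_cos_sq u + ρ ^ 2 * Real.sin_sq_add_cos_sq φ +
        (r * Real.cos u + ρ * Real.cos φ) * hc + (r * Real.sin u + ρ * Real.sin φ) * hs
    subst hρr
    have hc' := mul_left_cancel₀ hr.ne' hc
    have hs' := mul_left_cancel₀ hr.ne' hs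
    have h2 : Real.cos (u - φ) = 1 := by
      rw [Real.cos_sub, hc', hs']
      linear_combination Real.sin_sq_add_cos_sq φ
    have := (Real.cos_eq_one_iff_of_lt_of_lt (by linarith) (by linarith)).1 h2
    linarith
  · intro h
    exact ⟨r, u, hr.le, hu0.le, h, rfl, rfl⟩

theorem integral_indicator_complexSector_rotate {θ : ℝ} (hθ0 : 0 ≤ θ) (hθ : θ ≤ 2 * Real.pi) {z : ℂ}
    (hz : z ≠ 0) :
    ∫ s in (0 : ℝ)..2 * Real.pi,
      (complexSector θ).indicator (fun _ => (1 : ℂ)) (z * Complex.exp (s * Complex.I)) = θ := by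
  let χ (u : ℝ) : ℂ :=
    (complexSector θ).indicator (fun _ => (1 : ℂ)) (‖z‖ * Complex.exp (u * Complex.I))
  have hper : Function.Periodic χ (2 * Real.pi) := by
    intro u
    simp only [χ]
    congr 2
    push_cast
    rw [add_mul, Complex.exp_periodic]
  have hχ (s : ℝ) : (complexSector θ).indicator (fun _ => (1 : ℂ)) (z * Complex.exp (s * Complex.I))
      = χ (s + z.arg) := by
    simp only [χ]
    congr 1
    conv_lhs => rw [← Complex.norm_mul_exp_arg_mul_I z]
    rw [mul_assoc, ← Complex.exp_add]
    push_cast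
    ring_nf
  simp only [hχ]
  rw [intervalIntegral.integral_comp_add_right χ, zero_add, add_comm,
    hper.intervalIntegral_add_eq _ 0, zero_add]
  have hpi := Real.two_pi_pos
  trans ∫ u in (0 : ℝ)..2 * Real.pi, {u : ℝ | u ≤ θ}.indicator (fun _ => (1 : ℂ)) u
  · rw [intervalIntegral.integral_of_le hpi.le, intervalIntegral.integral_of_le hpi.le,
      integral_Ioc_eq_integral_Ioo, integral_Ioc_eq_integral_Ioo]
    refine setIntegral_congr_fun measurableSet_Ioo fun u hu => ?_
    have := mul_exp_mem_complexSector_iff hθ (norm_pos_iff.2 hz) hu.1 hu.2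
    simp only [χ, Set.indicator, this, Set.mem_ofPred_eq]
  · rw [intervalIntegral.integral_indicator ⟨hθ0, hθ⟩]
    simp

theorem toSphere_coordinate_eq_zero {ι : Type*} [Fintype ι] [DecidableEq ι] (i : ι) :
    (volume : Measure (EuclideanSpace ℝ ι)).toSphere {x | x.1 i = 0} = 0 := by
  have hm : MeasurableSet {x : sphere (0 : EuclideanSpace ℝ ι) 1 | x.1 i = 0} :=
    (isClosed_eq (by fun_prop) continuous_const).measurableSet
  rw [Measure.toSphere_apply' _ hm]
  let P : Submodule ℝ (EuclideanSpace ℝ ι) :=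
    LinearMap.ker (EuclideanSpace.proj (𝕜 := ℝ) i).toLinearMap
  have hP : P ≠ ⊤ := by
    intro h
    have : EuclideanSpace.single i (1 : ℝ) ∈ P := h ▸ Submodule.mem_top
    simp [P] at this
  have h0 := Measure.addHaar_submodule volume P hP
  rw [measure_mono_null ?_ h0, mul_zero]
  rintro _ ⟨r, -, _, ⟨x, hx, rfl⟩, rfl⟩
  have hxi : x.1 i = 0 := hx
  simp [P, hxi]

/-- The average over the rotations of the plane of the coordinates `i`, `j` shows that a sector of
angle `θ` in this plane carries the fraction `θ / (2 * π)` of the integral of an invariant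
function. -/
theorem setIntegral_sphere_sector {ι : Type*} [Fintype ι] [DecidableEq ι] {i j : ι} (hij : i ≠ j)
    {θ : ℝ} (hθ0 : 0 ≤ θ) (hθ : θ ≤ 2 * Real.pi) {g : sphere (0 : EuclideanSpace ℝ ι) 1 → ℂ}
    (hg : Continuous g) (hinv : ∀ t x, g ((planeRotation hij t).sphereMap x) = g x) :
    ∫ x in {x : sphere (0 : EuclideanSpace ℝ ι) 1 | (⟨x.1 i, x.1 j⟩ : ℂ) ∈ complexSector θ}, g x
        ∂(volume : Measure (EuclideanSpace ℝ ι)).toSphere =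
      (θ / (2 * Real.pi) : ℝ) * ∫ x, g x ∂(volume : Measure (EuclideanSpace ℝ ι)).toSphere := by
  set μ := (volume : Measure (EuclideanSpace ℝ ι)).toSphere with hμ
  let z (x : sphere (0 : EuclideanSpace ℝ ι) 1) : ℂ := ⟨x.1 i, x.1 j⟩
  have hz : Continuous z :=
    Complex.equivRealProdCLM.symm.continuous.comp
      (f := fun x : sphere (0 : EuclideanSpace ℝ ι) 1 => (x.1 i, x.1 j)) (by fun_prop)
  have hS := measurableSet_complexSector θ
  have hzrot (t x) : z ((planeRotation hij t).sphereMap x) = z x * Complex.exp (t * Complex.I) := by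
    apply Complex.ext <;>
    simp [z, LinearIsometry.sphereMap, planeRotation, hij.symm, Complex.exp_ofReal_mul_I_re,
      Complex.exp_ofReal_mul_I_im]
  let G (t : ℝ) (x : sphere (0 : EuclideanSpace ℝ ι) 1) : ℂ :=
    (complexSector θ).indicator (fun _ => (1 : ℂ)) (z x * Complex.exp (t * Complex.I)) * g x
  have hGm : Measurable (Function.uncurry G) := by
    have h1 : Measurable fun p : ℝ × sphere (0 : EuclideanSpace ℝ ι) 1 =>
        z p.2 * Complex.exp (p.1 * Complex.I) := by
      have : Continuous fun p : ℝ × sphere (0 : EuclideanSpace ℝ ι) 1 =>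
        z p.2 * Complex.exp (p.1 * Complex.I) := by fun_prop
      exact this.measurable
    exact ((measurable_const.indicator hS).comp h1).mul (hg.measurable.comp measurable_snd)
  obtain ⟨C, hC⟩ := isCompact_univ.exists_bound_of_continuousOn hg.continuousOn
  have hGb (t x) : ‖G t x‖ ≤ C := by
    refine le_trans ?_ (hC x (Set.mem_univ x))
    simp only [G, Set.indicator]
    split_ifs <;> simp
  have hconst (t : ℝ) : ∫ x, G t x ∂μ = ∫ x in {x | z x ∈ complexSector θ}, g x ∂μ := by
    have hmp := (planeRotation hij t).measurePreserving_sphereMap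
    rw [← hμ] at hmp
    change _ = ∫ x in z ⁻¹' complexSector θ, g x ∂μ
    rw [← integral_indicator (hz.measurable hS)]
    nth_rw 2 [← hmp.map_eq]
    rw [integral_map hmp.measurable.aemeasurable
      (hg.measurable.indicator (hz.measurable hS)).aestronglyMeasurable]
    refine integral_congr_ae (Eventually.of_forall fun x => ?_)
    have hmem : (planeRotation hij t).sphereMap x ∈ z ⁻¹' complexSector θ ↔
        z x * Complex.exp (t * Complex.I) ∈ complexSector θ := by rw [Set.mem_preimage, hzrot]
    by_cases h : z x * Complex.exp (t * Complex.I) ∈ complexSector θ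
    · simp only [G, Set.indicator_of_mem h, Set.indicator_of_mem (hmem.2 h), hinv, one_mul]
    · simp only [G, Set.indicator_of_notMem h, Set.indicator_of_notMem (mt hmem.1 h), zero_mul]
  have hswap : ∫ t in (0 : ℝ)..2 * Real.pi, ∫ x, G t x ∂μ =
      ∫ x, (∫ t in (0 : ℝ)..2 * Real.pi, G t x) ∂μ := by
    simp only [intervalIntegral.integral_of_le Real.two_pi_pos.le]
    refine integral_integral_swap (Integrable.of_bound hGm.aestronglyMeasurable C ?_)
    exact Eventually.of_forall fun p => hGb p.1 p.2
  have hinner : ∫ x, (∫ t in (0 : ℝ)..2 * Real.pi, G t x) ∂μ = ∫ x, θ * g x ∂μ := by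
    have hae : ∀ᵐ x ∂μ, x.1 i ≠ 0 := by
      rw [ae_iff]
      simpa using toSphere_coordinate_eq_zero i
    refine integral_congr_ae (hae.mono fun x hx => ?_)
    have hzx : z x ≠ 0 := fun h => hx (congrArg Complex.re h)
    simp only [G]
    rw [intervalIntegral.integral_mul_const, integral_indicator_complexSector_rotate hθ0 hθ hzx]
  simp only [hconst, intervalIntegral.integral_const] at hswap
  rw [hinner, integral_const_mul] at hswap
  have hpi : (Real.pi : ℂ) ≠ 0 := by exact_mod_cast Real.pi_ne_zero
  change ∫ x in {x | z x ∈ complexSector θ}, g x ∂μ = _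
  push_cast
  field_simp
  rw [← hswap, sub_zero, Complex.real_smul]
  push_cast
  ring

theorem integral_sphere_zpow_neg (n : ℕ) (hn : n ≠ 0) {ε : ℝ} (hε : 0 < ε) :
    ∫ x, ((x.1 0 : ℂ) - (ε : ℂ) * Complex.I) ^ (-(n : ℤ)) ∂sphereMeasure n =
      Complex.I ^ n * (((√(ε ^ 2 + 1) : ℝ) : ℂ) ^ n)⁻¹ * (sphereMeasure n Set.univ).toReal := by
  have hε' : (ε : ℂ) ≠ 0 := by exact_mod_cast hε.ne'
  have h1 : ∫ x, ((x.1 0 : ℂ) - (ε : ℂ) * Complex.I) ^ (-(n : ℤ)) ∂sphereMeasure n =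
      ((-(ε : ℂ) * Complex.I) ^ n)⁻¹ *
        ∫ x, ((1 + Complex.I * (ε⁻¹ * x.1 0 : ℝ) : ℂ) ^ n)⁻¹ ∂sphereMeasure n := by
    rw [← integral_const_mul]
    refine integral_congr_ae (Eventually.of_forall fun x => ?_)
    simp only [zpow_neg, zpow_natCast]
    rw [← mul_inv, ← mul_pow]
    congr 2
    push_cast
    field_simp
    linear_combination (x.1 0 : ℂ) * Complex.I_sq
  have hs : √(1 + ε⁻¹ ^ 2) = √(ε ^ 2 + 1) / ε := by
    rw [show 1 + ε⁻¹ ^ 2 = (ε ^ 2 + 1) / ε ^ 2 by field_simp, Real.sqrt_div (by positivity),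
      Real.sqrt_sq hε.le]
  have hne : ((√(ε ^ 2 + 1) : ℝ) : ℂ) ≠ 0 := by
    exact_mod_cast (Real.sqrt_pos.2 (by positivity)).ne'
  rw [h1, ← integral_sphere_inv_one_add_I_mul_pow n hn ε⁻¹, hs]
  have hI : ((-(ε : ℂ) * Complex.I) ^ n)⁻¹ = Complex.I ^ n * ((ε : ℂ) ^ n)⁻¹ := by
    rw [← inv_pow, ← inv_pow, ← mul_pow]
    congr 1
    rw [mul_inv, Complex.inv_I, inv_neg]
    ring
  rw [hI]
  push_cast
  rw [div_pow]
  generalize ∫ x, ((1 + Complex.I * ((ε : ℂ)⁻¹ * (x.1 0 : ℂ)) : ℂ) ^ n)⁻¹ ∂sphereMeasure n = J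
  field_simp

theorem lune_eq_preimage_complexSector (n : ℕ) (θ : ℝ) :
    lune n θ = {x | (⟨x.1 ⟨n - 1, by omega⟩, x.1 ⟨n, by omega⟩⟩ : ℂ) ∈ complexSector θ} :=
  rfl

/-- **Volume of a lune in the double hyperbolic space** (from the proof of Theorem 1.1):
`V_n(L^n_θ) = (θ / 2π) · iⁿ · σ(Sⁿ)`. -/
theorem volume_lune_double_hyperbolic (n : ℕ) (hn : 2 ≤ n) (θ : ℝ) (hθ0 : 0 ≤ θ)
    (hθ : θ ≤ 2 * Real.pi) :
    Tendsto
      (fun ε : ℝ =>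
        ∫ x in lune n θ,
          (((x : EuclideanSpace ℝ (Fin (n + 1))) 0 : ℂ) - (ε : ℂ) * Complex.I) ^ (-(n : ℤ))
          ∂(sphereMeasure n))
      (nhdsWithin 0 (Set.Ioi 0))
      (nhds ((θ / (2 * Real.pi) : ℝ) * Complex.I ^ n *
        ((sphereMeasure n Set.univ).toReal : ℂ))) := by
  have key : ∀ ε : ℝ, 0 < ε → ∫ x in lune n θ,
      (((x : EuclideanSpace ℝ (Fin (n + 1))) 0 : ℂ) - (ε : ℂ) * Complex.I) ^ (-(n : ℤ))
        ∂(sphereMeasure n) = (θ / (2 * Real.pi) : ℝ) * (Complex.I ^ n *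
          (((√(ε ^ 2 + 1) : ℝ) : ℂ) ^ n)⁻¹ * (sphereMeasure n Set.univ).toReal) := by
    intro ε hε
    have hij : (⟨n - 1, by omega⟩ : Fin (n + 1)) ≠ ⟨n, by omega⟩ := by
      simp only [ne_eq, Fin.mk.injEq]; omega
    have hi : (0 : Fin (n + 1)) ≠ ⟨n - 1, by omega⟩ := by
      simp only [ne_eq, Fin.ext_iff, Fin.val_zero]; omega
    have hj : (0 : Fin (n + 1)) ≠ ⟨n, by omega⟩ := by
      simp only [ne_eq, Fin.ext_iff, Fin.val_zero]; omega
    rw [← integral_sphere_zpow_neg n (by omega) hε, lune_eq_preimage_complexSector]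
    refine setIntegral_sphere_sector hij hθ0 hθ ?_ fun t x => ?_
    · simp only [zpow_neg, zpow_natCast]
      refine Continuous.inv₀ (by fun_prop) fun x => pow_ne_zero n fun h => ?_
      have := congrArg Complex.im h
      simp at this
      exact hε.ne' this
    · simp only [LinearIsometry.sphereMap, planeRotation, LinearIsometry.coe_mk, LinearMap.coe_mk,
        AddHom.coe_mk, hi, hj, if_false]
  have hlim : Tendsto (fun ε : ℝ => ((θ / (2 * Real.pi) : ℝ) : ℂ) * (Complex.I ^ n *
      (((√(ε ^ 2 + 1) : ℝ) : ℂ) ^ n)⁻¹ * (sphereMeasure n Set.univ).toReal)) (nhds 0)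
      (nhds ((θ / (2 * Real.pi) : ℝ) * Complex.I ^ n *
        ((sphereMeasure n Set.univ).toReal : ℂ))) := by
    have hc : Continuous fun ε : ℝ => (((√(ε ^ 2 + 1) : ℝ) : ℂ) ^ n)⁻¹ := by
      refine Continuous.inv₀ (by fun_prop) fun ε => pow_ne_zero n ?_
      exact_mod_cast (Real.sqrt_pos.2 (by positivity)).ne'
    have := (((hc.const_mul (Complex.I ^ n)).mul_const
      ((sphereMeasure n Set.univ).toReal : ℂ)).const_mul ((θ / (2 * Real.pi) : ℝ) : ℂ)).tendsto 0
    simpa [mul_assoc] using this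
  refine (hlim.mono_left nhdsWithin_le_nhds).congr' ?_
  filter_upwards [self_mem_nhdsWithin] with ε hε
  exact (key ε hε).symm
end
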